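/- Assume η₁ > 0 satisfies: (i) a₀·y − a₁·(y − a₁·η₁) < 0 for every y ≥ 1−y₀; (ii) η₁ < x₀ − y₀; (iii) f₁(y₀ + a₁·η₁) < x₀. Let 1−x₀ ≤ x < y ≤ x₀ with y − x < a₁·η₁ and y > 1−y₀, let ω ∈ Σ and let u be a natural number such that f^n_ω(y) ≤ x₀ for all n ≤ u. Then |f^n_ω(x) − f^n_ω(y)| ≤ y − x for all n ≤ u. -/

import Mathlib

/-
Formalization of the Alsedà–Misiurewicz system setup:
`f0, f1` are the piecewise-linear interval homeomorphisms, `iter` the random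
iteration along ω ∈ Σ = {0,1}^ℕ, `IsKernel` characterises the family x ↦ ℙ_x by
its values on cylinder sets, `Pop` is the Markov operator (as a set function),
`Stationary` expresses P-invariance for probability measures on (0,1), `U` is
the dual operator, and `A1`–`A4` are the assumptions of the paper.
-/

open MeasureTheory Filter Set
open scoped ENNReal Topology

namespace AM

noncomputable def f0 (x₀ y₀ : ℝ) (x : ℝ) : ℝ :=
  if x ≤ x₀ then (y₀ / x₀) * x else ((1 - y₀) / (1 - x₀)) * (x - 1) + 1

noncomputable def f1 (x₀ y₀ : ℝ) (x : ℝ) : ℝ := 1 - f0 x₀ y₀ (1 - x)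

/-- `fb b` is `f₁` if `b = true`, and `f₀` if `b = false`. -/
noncomputable def fb (x₀ y₀ : ℝ) (b : Bool) : ℝ → ℝ :=
  if b then f1 x₀ y₀ else f0 x₀ y₀

/-- `iter x₀ y₀ ω n x = f^n_ω(x) = f_{ω (n-1)} ∘ ⋯ ∘ f_{ω 0} (x)`, with `f^0_ω = id`. -/
noncomputable def iter (x₀ y₀ : ℝ) (ω : ℕ → Bool) : ℕ → ℝ → ℝ
  | 0, x => x
  | n + 1, x => fb x₀ y₀ (ω n) (iter x₀ y₀ ω n x)

/-- `cylProb x₀ y₀ p₀ p₁ x w = p_{i₁}(x) p_{i₂}(f_{i₁} x) ⋯` for the word `w = (i₁, …, i_k)`. -/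
noncomputable def cylProb (x₀ y₀ : ℝ) (p₀ p₁ : ℝ → ℝ) : ℝ → List Bool → ℝ
  | _, [] => 1
  | x, b :: w => (if b then p₁ x else p₀ x) * cylProb x₀ y₀ p₀ p₁ (fb x₀ y₀ b x) w

/-- The cylinder set of sequences starting with the word `w`. -/
def cyl (w : List Bool) : Set (ℕ → Bool) := {ω | ∀ j : Fin w.length, ω j = w.get j}

/-- `IsKernel x₀ y₀ p₀ p₁ Pm` says that `Pm x = ℙ_x` for all `x ∈ (0,1)`, i.e. `Pm x` gives
every cylinder set its prescribed probability (this determines `Pm x` uniquely and makes it a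
probability measure, since the empty word gives `Pm x univ = 1`). -/
def IsKernel (x₀ y₀ : ℝ) (p₀ p₁ : ℝ → ℝ) (Pm : ℝ → Measure (ℕ → Bool)) : Prop :=
  ∀ x ∈ Ioo (0:ℝ) 1, ∀ w : List Bool,
    Pm x (cyl w) = ENNReal.ofReal (cylProb x₀ y₀ p₀ p₁ x w)

/-- The Markov operator `P`, as a set function:
`Pop μ A = ∫_{f₀⁻¹(A)} p₀ dμ + ∫_{f₁⁻¹(A)} p₁ dμ`. -/
noncomputable def Pop (x₀ y₀ : ℝ) (p₀ p₁ : ℝ → ℝ) (μ : Measure ℝ) (A : Set ℝ) : ℝ≥0∞ :=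
  (∫⁻ x in f0 x₀ y₀ ⁻¹' A, ENNReal.ofReal (p₀ x) ∂μ) +
    ∫⁻ x in f1 x₀ y₀ ⁻¹' A, ENNReal.ofReal (p₁ x) ∂μ

/-- A stationary (P-invariant) Borel probability measure on (0,1). -/
def Stationary (x₀ y₀ : ℝ) (p₀ p₁ : ℝ → ℝ) (μ : Measure ℝ) : Prop :=
  IsProbabilityMeasure μ ∧ μ (Ioo 0 1) = 1 ∧
    ∀ A : Set ℝ, MeasurableSet A → A ⊆ Ioo 0 1 → μ A = Pop x₀ y₀ p₀ p₁ μ A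

/-- The dual operator `Uφ(x) = p₀(x) φ(f₀ x) + p₁(x) φ(f₁ x)`. -/
noncomputable def U (x₀ y₀ : ℝ) (p₀ p₁ : ℝ → ℝ) (φ : ℝ → ℝ) : ℝ → ℝ :=
  fun x => p₀ x * φ (f0 x₀ y₀ x) + p₁ x * φ (f1 x₀ y₀ x)

/-- Assumption (A1): `1/2 < x₀ < 1` and `1/2 ≤ y₀ < x₀`. -/
def A1 (x₀ y₀ : ℝ) : Prop := 1/2 < x₀ ∧ x₀ < 1 ∧ 1/2 ≤ y₀ ∧ y₀ < x₀

/-- Assumption (A2): Dini continuity of `p₀, p₁`; `β` is a modulus of continuity for both, with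
`∑ₙ β(C tⁿ) < ∞` for all `C ≥ 0`, `0 < t < 1`. (Such a `β` exists iff the least modulus of
continuity has this summability property.) -/
def A2 (p₀ p₁ : ℝ → ℝ) : Prop :=
  ∃ β : ℝ → ℝ,
    (∀ t : ℝ, ∀ x ∈ Icc (0:ℝ) 1, ∀ y ∈ Icc (0:ℝ) 1, |x - y| ≤ t →
      |p₀ x - p₀ y| ≤ β t ∧ |p₁ x - p₁ y| ≤ β t) ∧
    (∀ C : ℝ, 0 ≤ C → ∀ t : ℝ, 0 < t → t < 1 → Summable fun n : ℕ => β (C * t ^ n))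

/-- Assumption (A3): `p₀, p₁` are continuous, `p₀ + p₁ = 1`, and `0 < pᵢ < 1` on `[0,1]`. -/
def A3 (p₀ p₁ : ℝ → ℝ) : Prop :=
  ContinuousOn p₀ (Icc 0 1) ∧ ContinuousOn p₁ (Icc 0 1) ∧
    ∀ x ∈ Icc (0:ℝ) 1, p₀ x + p₁ x = 1 ∧ 0 < p₀ x ∧ p₀ x < 1 ∧ 0 < p₁ x ∧ p₁ x < 1

/-- Assumption (A4): the average Lyapunov exponents at 0 and 1 are positive
(`a₀ = y₀/x₀`, `a₁ = (1-y₀)/(1-x₀)`). -/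
def A4 (x₀ y₀ : ℝ) (p₀ p₁ : ℝ → ℝ) : Prop :=
  0 < p₀ 0 * Real.log (y₀ / x₀) + p₁ 0 * Real.log ((1 - y₀) / (1 - x₀)) ∧
    0 < p₀ 1 * Real.log ((1 - y₀) / (1 - x₀)) + p₁ 1 * Real.log (y₀ / x₀)

end AM

namespace AM

theorem f0_of_le {x₀ y₀ x : ℝ} (h : x ≤ x₀) : f0 x₀ y₀ x = y₀ / x₀ * x := if_pos h

theorem f1_of_le {x₀ y₀ x : ℝ} (h : 1 - x₀ ≤ x) :
    f1 x₀ y₀ x = 1 - y₀ / x₀ + y₀ / x₀ * x := by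
  rw [f1, f0_of_le (by linarith)]; ring

theorem f1_of_lt {x₀ y₀ x : ℝ} (h : x < 1 - x₀) :
    f1 x₀ y₀ x = (1 - y₀) / (1 - x₀) * x := by
  rw [f1, f0, if_neg (by linarith)]; ring

/-- The points `x ≤ y` are at distance at most `D`, and also at distance at most
`D * y / (1 - y₀)`. -/
structure IsClose (y₀ D x y : ℝ) : Prop where
  le : x ≤ y
  dist_le : y - x ≤ D
  dist_mul_le : (y - x) * (1 - y₀) ≤ D * y

theorem IsClose.f0 {x₀ y₀ D x y : ℝ} (hA1 : A1 x₀ y₀) (hy : y ≤ x₀) (h : IsClose y₀ D x y) :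
    IsClose y₀ D (f0 x₀ y₀ x) (f0 x₀ y₀ y) := by
  obtain ⟨h1, h2, h3, h4⟩ := hA1
  obtain ⟨hle, hd, hm⟩ := h
  rw [f0_of_le hy, f0_of_le (hle.trans hy)]
  have ha : 0 < y₀ / x₀ := by apply div_pos <;> linarith
  have ha' : y₀ / x₀ < 1 := by rw [div_lt_one (by linarith)]; exact h4
  generalize y₀ / x₀ = a at *
  exact ⟨by gcongr, by nlinarith, by nlinarith⟩

theorem IsClose.f1 {x₀ y₀ D x y : ℝ} (hA1 : A1 x₀ y₀)
    (hD : y₀ / x₀ * (1 - y₀) - (1 - y₀) / (1 - x₀) * (1 - y₀ - D) ≤ 0)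
    (h : IsClose y₀ D x y) :
    IsClose y₀ D (f1 x₀ y₀ x) (f1 x₀ y₀ y) := by
  obtain ⟨h1, h2, h3, h4⟩ := hA1
  obtain ⟨hle, hd, hm⟩ := h
  have ha : 0 < y₀ / x₀ := by apply div_pos <;> linarith
  have ha' : y₀ / x₀ < 1 := by rw [div_lt_one (by linarith)]; exact h4
  have hb : 0 < (1 - y₀) / (1 - x₀) := by apply div_pos <;> linarith
  have hax : y₀ / x₀ * x₀ = y₀ := div_mul_cancel₀ _ (by linarith)
  have hbx : (1 - y₀) / (1 - x₀) * (1 - x₀) = 1 - y₀ := div_mul_cancel₀ _ (by linarith)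
  have hD0 : 0 ≤ D := by linarith
  have hq : 0 < 1 - y₀ := by linarith
  rcases lt_or_ge y (1 - x₀) with hy | hy
  · rw [f1_of_lt hy, f1_of_lt (hle.trans_lt hy)]
    generalize (1 - y₀) / (1 - x₀) = b at *
    have hm' : (b * y - b * x) * (1 - y₀) ≤ D * (b * y) := by nlinarith
    refine ⟨by gcongr, ?_, hm'⟩
    have hby : b * y ≤ 1 - y₀ := by rw [← hbx]; gcongr
    have : D * (b * y) ≤ D * (1 - y₀) := by gcongr
    exact le_of_mul_le_mul_right (hm'.trans this) hq
  · have hy' : 1 - y₀ ≤ AM.f1 x₀ y₀ y := by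
      rw [f1_of_le hy]
      nlinarith
    suffices AM.f1 x₀ y₀ x ≤ AM.f1 x₀ y₀ y ∧ AM.f1 x₀ y₀ y - AM.f1 x₀ y₀ x ≤ D from
      ⟨this.1, this.2, by gcongr; exact this.2⟩
    rcases lt_or_ge x (1 - x₀) with hx | hx
    · refine ⟨?_, ?_⟩
      · refine le_trans ?_ hy'
        rw [f1_of_lt hx]
        exact (mul_le_mul_of_nonneg_left hx.le hb.le).trans_eq hbx
      · rw [f1_of_le hy, f1_of_lt hx]
        generalize (1 - y₀) / (1 - x₀) = b at *
        generalize y₀ / x₀ = a at *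
        refine le_of_mul_le_mul_right ?_ hq
        have e1 : (y - (1 - x₀)) * (a * (1 - y₀) - b * (1 - y₀ - D)) ≤ 0 :=
          mul_nonpos_of_nonneg_of_nonpos (by linarith) hD
        have e2 := mul_le_mul_of_nonneg_left hm hb.le
        linear_combination e1 + e2 - (1 - y₀) * hax - (1 - y₀ - D) * hbx
    · rw [f1_of_le hy, f1_of_le hx]
      generalize y₀ / x₀ = a at *
      exact ⟨by gcongr, by nlinarith⟩

end AM

/-- Lemma 1: with `η₁` as in Statement 4, if `1−x₀ ≤ x < y ≤ x₀`,
`y − x < a₁ η₁`, `y > 1−y₀`, and `f^n_ω(y) ≤ x₀` for all `n ≤ u`, then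
`|f^n_ω(x) − f^n_ω(y)| ≤ y − x` for all `n ≤ u`. -/
theorem stmt6 (x₀ y₀ : ℝ) (hA1 : AM.A1 x₀ y₀)
    (η₁ : ℝ) (hη : 0 < η₁)
    (hi : ∀ y : ℝ, 1 - y₀ ≤ y →
      (y₀ / x₀) * y - ((1 - y₀) / (1 - x₀)) * (y - ((1 - y₀) / (1 - x₀)) * η₁) < 0)
    (hii : η₁ < x₀ - y₀)
    (hiii : AM.f1 x₀ y₀ (y₀ + ((1 - y₀) / (1 - x₀)) * η₁) < x₀)
    (x y : ℝ) (hx : 1 - x₀ ≤ x) (hxy : x < y) (hy : y ≤ x₀)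
    (hclose : y - x < ((1 - y₀) / (1 - x₀)) * η₁) (hy0 : 1 - y₀ < y)
    (ω : ℕ → Bool) (u : ℕ) (hu : ∀ n ≤ u, AM.iter x₀ y₀ ω n y ≤ x₀) :
    ∀ n ≤ u, |AM.iter x₀ y₀ ω n x - AM.iter x₀ y₀ ω n y| ≤ y - x := by
  have hD : y₀ / x₀ * (1 - y₀) - (1 - y₀) / (1 - x₀) * (1 - y₀ - (y - x)) ≤ 0 := by
    obtain ⟨h1, h2, h3, h4⟩ := hA1
    have hb : 0 < (1 - y₀) / (1 - x₀) := by apply div_pos <;> linarith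
    have := mul_lt_mul_of_pos_left hclose hb
    linarith [hi (1 - y₀) le_rfl]
  have key : ∀ n ≤ u,
      AM.IsClose y₀ (y - x) (AM.iter x₀ y₀ ω n x) (AM.iter x₀ y₀ ω n y) := by
    intro n
    induction n with
    | zero => exact fun _ => ⟨hxy.le, le_rfl, mul_le_mul_of_nonneg_left hy0.le (sub_nonneg.2 hxy.le)⟩
    | succ n ih =>
      intro hn
      have hc := ih (by omega)
      simp only [AM.iter, AM.fb]
      split_ifs
      · exact hc.f1 hA1 hD
      · exact hc.f0 hA1 (hu n (by omega))
  intro n hn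
  rw [abs_sub_comm, abs_of_nonneg (sub_nonneg.2 (key n hn).le)]
  exact (key n hn).dist_le
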